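/- (Quillen's Theorem A) Let f : I → J be a functor between small categories. If for every object y of J the nerve of the comma category f↓y is weakly contractible, then the induced map on nerves N f : N I → N J is a weak homotopy equivalence. -/

import Mathlib

open CategoryTheory CategoryTheory.Limits Simplicial MonoidalCategory SSet

noncomputable instance : MonoidalClosed SSet.{0} :=
  (inferInstance : MonoidalClosed (SimplexCategoryᵒᵖ ⥤ Type 0))

namespace Paper

/-- A map of simplicial sets is a *trivial fibration* if it has the right lifting
property with respect to all boundary inclusions `∂Δ[n] ⟶ Δ[n]` for `n ≥ 0`. -/
def TrivialFibration {X Y : SSet.{0}} (p : X ⟶ Y) : Prop :=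
  ∀ n : ℕ, HasLiftingProperty (SSet.boundary n).ι p

/-- A map of simplicial sets is a *Kan fibration* if it has the right lifting property
with respect to all horn inclusions `Λ[n, i] ⟶ Δ[n]` for `n ≥ 1`, `0 ≤ i ≤ n`. -/
def KanFibration {X Y : SSet.{0}} (p : X ⟶ Y) : Prop :=
  ∀ (n : ℕ) (i : Fin (n + 2)), HasLiftingProperty (SSet.horn (n + 1) i).ι p

/-- An *anodyne* map is one with the left lifting property with respect to
all Kan fibrations. -/
def Anodyne {A B : SSet.{0}} (i : A ⟶ B) : Prop :=
  ∀ ⦃X Y : SSet.{0}⦄ (p : X ⟶ Y), KanFibration p → HasLiftingProperty i p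

/-- The unique map to `Δ[0]`. -/
def toPt (X : SSet.{0}) : X ⟶ Δ[0] where
  app m := ↾fun _ => SSet.stdSimplex.const 0 0 m
  naturality := by
    intro m m' φ
    ext x : 3
    apply stdSimplex.objEquiv.injective
    apply SimplexCategory.Hom.ext
    apply OrderHom.ext
    funext j
    exact @Subsingleton.elim (Fin 1) _ _ _

/-- A *Kan complex* is a simplicial set whose map to `Δ[0]` is a Kan fibration. -/
def KanComplex (X : SSet.{0}) : Prop :=
  KanFibration (toPt X)

/-- The constant map at the vertex `k` of `Δ[1]`. -/
def cst (X : SSet.{0}) (k : Fin 2) : X ⟶ Δ[1] where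
  app m := ↾fun _ => SSet.stdSimplex.const 1 k m
  naturality := by
    intro m m' φ
    ext x : 3
    apply stdSimplex.objEquiv.injective
    apply SimplexCategory.Hom.ext
    ext j
    rfl

/-- The endpoint inclusion `X ⟶ X ⊗ Δ[1]` at the vertex `k` of `Δ[1]`. -/
noncomputable def ept (X : SSet.{0}) (k : Fin 2) : X ⟶ X ⊗ Δ[1] :=
  CartesianMonoidalCategory.lift (𝟙 X) (cst X k)

/-- A (single-step) homotopy from `f` to `g`, as a property of the pair `(f, g)`. -/
def Homotopy {X Y : SSet.{0}} (f g : X ⟶ Y) : Prop :=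
  ∃ H : X ⊗ Δ[1] ⟶ Y, ept X 0 ≫ H = f ∧ ept X 1 ≫ H = g

/-- `f` and `g` are *homotopic* if they are connected by a zig-zag of homotopies. -/
def Homotopic {X Y : SSet.{0}} (f g : X ⟶ Y) : Prop :=
  Relation.EqvGen Homotopy f g

/-- A *homotopy equivalence* of simplicial sets. -/
def HomotopyEquivalence {X Y : SSet.{0}} (f : X ⟶ Y) : Prop :=
  ∃ g : Y ⟶ X, Homotopic (f ≫ g) (𝟙 X) ∧ Homotopic (g ≫ f) (𝟙 Y)

/-- A map `f : X ⟶ Y` is a *weak homotopy equivalence* if for every Kan complex `K`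
the induced map `K^Y ⟶ K^X` on exponentials is a homotopy equivalence. -/
def WeakHomotopyEquivalence {X Y : SSet.{0}} (f : X ⟶ Y) : Prop :=
  ∀ K : SSet.{0}, KanComplex K → HomotopyEquivalence ((MonoidalClosed.pre f).app K)

/-- A homotopy `H` between maps over `B` which is *fiberwise over `B`*. -/
def FibHomotopy {B X Y : SSet.{0}} (pX : X ⟶ B) (pY : Y ⟶ B) (f g : X ⟶ Y) : Prop :=
  ∃ H : X ⊗ Δ[1] ⟶ Y, ept X 0 ≫ H = f ∧ ept X 1 ≫ H = g ∧
    H ≫ pY = CartesianMonoidalCategory.fst X Δ[1] ≫ pX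

/-- Connectedness by a zig-zag of fiberwise homotopies over `B`. -/
def FibHomotopic {B X Y : SSet.{0}} (pX : X ⟶ B) (pY : Y ⟶ B) (f g : X ⟶ Y) : Prop :=
  Relation.EqvGen (FibHomotopy pX pY) f g

/-- A *fiberwise homotopy equivalence over `B`*. -/
def FibHomotopyEquivalence {B X Y : SSet.{0}} (pX : X ⟶ B) (pY : Y ⟶ B) (f : X ⟶ Y) : Prop :=
  f ≫ pY = pX ∧ ∃ g : Y ⟶ X, g ≫ pX = pY ∧
    FibHomotopic pX pX (f ≫ g) (𝟙 X) ∧ FibHomotopic pY pY (g ≫ f) (𝟙 Y)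

end Paper


namespace Paper

/-- A simplicial set is *weakly contractible* if its map to `Δ[0]` is a weak homotopy
equivalence. -/
def WeaklyContractible (Z : SSet.{0}) : Prop :=
  WeakHomotopyEquivalence (toPt Z)

end Paper

namespace Paper

open CartesianMonoidalCategory

lemma congr_app_apply {X Y : SSet.{0}} {f g : X ⟶ Y} (h : f = g) (m : SimplexCategoryᵒᵖ)
    (x : X.obj m) : f.app m x = g.app m x := by rw [h]

section HomotopyBasics

lemma comp_toPt {X Y : SSet.{0}} (f : X ⟶ Y) : f ≫ toPt Y = toPt X := rfl

lemma ept_fst (X : SSet.{0}) (k : Fin 2) : ept X k ≫ fst X Δ[1] = 𝟙 X := by simp [ept]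

lemma ept_fst_assoc {X Y : SSet.{0}} (k : Fin 2) (f : X ⟶ Y) : ept X k ≫ fst X Δ[1] ≫ f = f := by
  rw [← Category.assoc, ept_fst, Category.id_comp]

lemma ept_whiskerRight_assoc {X Y Z : SSet.{0}} (f : X ⟶ Y) (k : Fin 2) (g : Y ⊗ Δ[1] ⟶ Z) :
    ept X k ≫ f ▷ Δ[1] ≫ g = f ≫ ept Y k ≫ g := rfl

lemma Homotopy.refl {X Y : SSet.{0}} (f : X ⟶ Y) : Homotopy f f :=
  ⟨fst _ _ ≫ f, ept_fst_assoc _ _, ept_fst_assoc _ _⟩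

lemma Homotopy.postcomp {X Y Z : SSet.{0}} {f g : X ⟶ Y} (h : Homotopy f g) (k : Y ⟶ Z) :
    Homotopy (f ≫ k) (g ≫ k) := by
  obtain ⟨H, rfl, rfl⟩ := h
  exact ⟨H ≫ k, by simp, by simp⟩

lemma Homotopy.precomp {X Y Z : SSet.{0}} {f g : Y ⟶ Z} (h : Homotopy f g) (k : X ⟶ Y) :
    Homotopy (k ≫ f) (k ≫ g) := by
  obtain ⟨H, rfl, rfl⟩ := h
  exact ⟨k ▷ _ ≫ H, by rw [ept_whiskerRight_assoc], by rw [ept_whiskerRight_assoc]⟩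

lemma Homotopic.of {X Y : SSet.{0}} {f g : X ⟶ Y} (h : Homotopy f g) : Homotopic f g := .rel _ _ h

lemma Homotopic.refl {X Y : SSet.{0}} (f : X ⟶ Y) : Homotopic f f := Relation.EqvGen.refl _

lemma Homotopic.symm {X Y : SSet.{0}} {f g : X ⟶ Y} (h : Homotopic f g) : Homotopic g f :=
  Relation.EqvGen.symm _ _ h

lemma Homotopic.trans {X Y : SSet.{0}} {f g k : X ⟶ Y} (h : Homotopic f g)
    (h' : Homotopic g k) : Homotopic f k :=
  Relation.EqvGen.trans _ _ _ h h'

lemma Homotopic.map {X Y X' Y' : SSet.{0}} (F : (X ⟶ Y) → (X' ⟶ Y'))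
    (hF : ∀ f g, Homotopy f g → Homotopy (F f) (F g)) {f g : X ⟶ Y} (h : Homotopic f g) :
    Homotopic (F f) (F g) := by
  induction h with
  | rel _ _ h => exact .rel _ _ (hF _ _ h)
  | refl _ => exact .refl _
  | symm _ _ _ ih => exact ih.symm
  | trans _ _ _ _ _ ih₁ ih₂ => exact ih₁.trans ih₂

lemma Homotopic.postcomp {X Y Z : SSet.{0}} {f g : X ⟶ Y} (h : Homotopic f g) (k : Y ⟶ Z) :
    Homotopic (f ≫ k) (g ≫ k) :=
  h.map (· ≫ k) fun _ _ h ↦ h.postcomp k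

lemma Homotopic.precomp {X Y Z : SSet.{0}} {f g : Y ⟶ Z} (h : Homotopic f g) (k : X ⟶ Y) :
    Homotopic (k ≫ f) (k ≫ g) :=
  h.map (k ≫ ·) fun _ _ h ↦ h.precomp k

end HomotopyBasics

section Boundary

/-- A simplex of `∂Δ[1]` is constant. -/
lemma eq_const_of_mem_boundary {m : SimplexCategoryᵒᵖ} (s : (Δ[1] : SSet.{0}).obj m)
    (hs : s ∈ (∂Δ[1] : (Δ[1] : SSet.{0}).Subcomplex).obj m) :
    s = stdSimplex.const 1 0 m ∨ s = stdSimplex.const 1 1 m := by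
  obtain ⟨m⟩ := m
  induction m using SimplexCategory.rec with | _ m
  have h : ∃ k : Fin 2, ∀ j, s j ≠ k := by
    by_contra! h
    exact hs h
  obtain ⟨k, hk⟩ := h
  obtain rfl | rfl : k = 0 ∨ k = 1 := (by decide : ∀ a : Fin 2, a = 0 ∨ a = 1) k
  · right
    ext j : 1
    have := hk j
    exact (Fin.eq_one_of_ne_zero _ this)
  · left
    ext j : 1
    have := hk j
    exact (by decide : ∀ a : Fin 2, a ≠ 1 → a = 0) _ this

lemma const_one_ne_const_zero (m : SimplexCategoryᵒᵖ) :
    (stdSimplex.const 1 1 m : (Δ[1] : SSet.{0}).obj m) ≠ stdSimplex.const 1 0 m := by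
  intro h
  have := congr_arg (fun s ↦ (stdSimplex.objEquiv s).toOrderHom 0) h
  exact one_ne_zero (α := Fin 2) this

open Classical in
/-- The map on `B ⊗ ∂Δ[1]` given by `u` at the vertex `0` and `v` at the vertex `1`. -/
noncomputable def endpoints {B E : SSet.{0}} (u v : B ⟶ E) :
    B ⊗ (∂Δ[1] : (Δ[1] : SSet.{0}).Subcomplex).toSSet ⟶ E where
  app m := ↾fun x ↦ if x.2.1 = stdSimplex.const 1 0 m then u.app m x.1 else v.app m x.1
  naturality := by
    intro m m' φ
    ext ⟨x, s, hs⟩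
    obtain rfl | rfl := eq_const_of_mem_boundary s hs
    · refine (if_pos rfl).trans ?_
      refine (NatTrans.naturality_apply u φ x).trans ?_
      exact congr_arg (E.map φ) (if_pos rfl).symm
    · refine (if_neg (const_one_ne_const_zero _)).trans ?_
      refine (NatTrans.naturality_apply v φ x).trans ?_
      exact congr_arg (E.map φ) (if_neg (const_one_ne_const_zero _)).symm

lemma whiskerLeft_boundary_ι {B E : SSet.{0}} (H : B ⊗ Δ[1] ⟶ E) :
    B ◁ (∂Δ[1] : (Δ[1] : SSet.{0}).Subcomplex).ι ≫ H = endpoints (ept B 0 ≫ H) (ept B 1 ≫ H) := by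
  ext m ⟨x, s, hs⟩
  obtain rfl | rfl := eq_const_of_mem_boundary s hs
  · exact (if_pos rfl).symm
  · exact (if_neg (const_one_ne_const_zero _)).symm

lemma mem_boundary_const (k : Fin 2) (m : SimplexCategoryᵒᵖ) :
    stdSimplex.const 1 k m ∈ (∂Δ[1] : (Δ[1] : SSet.{0}).Subcomplex).obj m := by
  intro h
  obtain ⟨j, hj⟩ := h (k + 1)
  have : k = k + 1 := hj
  fin_cases k <;> simp at this

lemma ept_comp_eq_of_endpoints {B E : SSet.{0}} {u v : B ⟶ E} {H : B ⊗ Δ[1] ⟶ E}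
    (h : B ◁ (∂Δ[1] : (Δ[1] : SSet.{0}).Subcomplex).ι ≫ H = endpoints u v) :
    ept B 0 ≫ H = u ∧ ept B 1 ≫ H = v := by
  constructor
  · ext m x
    exact (congr_app_apply h m (x, (⟨_, mem_boundary_const 0 m⟩ : (boundary 1).obj m))).trans
      (if_pos rfl)
  · ext m x
    exact (congr_app_apply h m (x, (⟨_, mem_boundary_const 1 m⟩ : (boundary 1).obj m))).trans
      (if_neg (const_one_ne_const_zero _))

lemma whiskerRight_endpoints {A B E : SSet.{0}} (i : A ⟶ B) (u v : B ⟶ E) :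
    i ▷ _ ≫ endpoints u v = endpoints (i ≫ u) (i ≫ v) := rfl

lemma endpoints_comp {B E E' : SSet.{0}} (u v : B ⟶ E) (k : E ⟶ E') :
    endpoints u v ≫ k = endpoints (u ≫ k) (v ≫ k) := by
  classical
  ext m ⟨x, s⟩
  exact apply_ite (k.app m) _ _ _

instance mono_whiskerLeft (B : SSet.{0}) {C D : SSet.{0}} (j : C ⟶ D) [Mono j] : Mono (B ◁ j) where
  right_cancellation g h e := by
    refine hom_ext _ _ ?_ ?_
    · simpa using e =≫ fst _ _
    · rw [← cancel_mono j]
      simpa using e =≫ snd _ _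

/-- Maps which agree after composition with a trivial fibration are homotopic. -/
lemma Homotopy.of_rlp {B E Y : SSet.{0}} {p : E ⟶ Y}
    (hp : (MorphismProperty.monomorphisms SSet.{0}).rlp p)
    {u v : B ⟶ E} (h : u ≫ p = v ≫ p) : Homotopy u v := by
  have := hp (B ◁ (∂Δ[1] : (Δ[1] : SSet.{0}).Subcomplex).ι) (.infer_property _)
  have sq : CommSq (endpoints u v) (B ◁ (∂Δ[1] : (Δ[1] : SSet.{0}).Subcomplex).ι) p
      (fst _ _ ≫ u ≫ p) := ⟨by
    rw [endpoints_comp, whiskerLeft_boundary_ι, ← h, ept_fst_assoc, ept_fst_assoc]⟩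
  exact ⟨sq.lift, ept_comp_eq_of_endpoints sq.fac_left⟩

end Boundary

section Kan

lemma KanComplex.rlp {K : SSet.{0}} (hK : KanComplex K) :
    SSet.modelCategoryQuillen.J.rlp (toPt K) := by
  intro _ _ _ h
  simp only [SSet.modelCategoryQuillen.J, MorphismProperty.iSup_iff] at h
  obtain ⟨m, ⟨k⟩⟩ := h
  exact hK m k

lemma KanComplex.of_rlp {K : SSet.{0}} (hK : SSet.modelCategoryQuillen.J.rlp (toPt K)) :
    KanComplex K :=
  fun n i ↦ hK _ (SSet.modelCategoryQuillen.horn_ι_mem_J (n + 1) i)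

lemma hom_ext_pt {X : SSet.{0}} (f g : X ⟶ Δ[0]) : f = g :=
  stdSimplex.isTerminalObj₀.hom_ext _ _

lemma KanComplex.exists_extension {K : SSet.{0}} (hK : KanComplex K) {A B : SSet.{0}} {i : A ⟶ B}
    (hi : anodyneExtensions i) (u : A ⟶ K) : ∃ v : B ⟶ K, i ≫ v = u := by
  have := hi _ hK.rlp
  have sq : CommSq u i (toPt K) (toPt B) := ⟨hom_ext_pt _ _⟩
  exact ⟨sq.lift, sq.fac_left⟩

/-- A map into a Kan complex extends along a pushout-product which is anodyne. -/
lemma KanComplex.exists_extension₂ {K : SSet.{0}} (hK : KanComplex K) {A B C D : SSet.{0}}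
    {i : A ⟶ B} {j : C ⟶ D}
    (hij : Mono j ∧ anodyneExtensions i ∨ Mono i ∧ anodyneExtensions j)
    (u : B ⊗ C ⟶ K) (v : A ⊗ D ⟶ K) (huv : i ▷ C ≫ u = A ◁ j ≫ v) :
    ∃ w : B ⊗ D ⟶ K, B ◁ j ≫ w = u ∧ i ▷ D ≫ w = v := by
  let sq := Functor.PushoutObjObj.ofHasPushout (curriedTensor SSet.{0}) i j
  have hsq : anodyneExtensions sq.ι := hij.elim
    (fun ⟨_, h⟩ ↦ anodyneExtensions_pushoutObjObjι' sq h)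
    (fun ⟨_, h⟩ ↦ anodyneExtensions_pushoutObjObjι sq h)
  obtain ⟨w, hw⟩ := hK.exists_extension hsq (sq.isPushout.desc u v huv)
  refine ⟨w, ?_, ?_⟩
  · have := sq.inl ≫= hw
    rw [sq.isPushout.inl_desc, sq.inl_ι_assoc] at this
    exact this
  · have := sq.inr ≫= hw
    rw [sq.isPushout.inr_desc, sq.inr_ι_assoc] at this
    exact this

lemma Homotopy.of_precomp_anodyne {A B K : SSet.{0}} (hK : KanComplex K) {i : A ⟶ B}
    (hi : anodyneExtensions i) {u v : B ⟶ K} (h : Homotopy (i ≫ u) (i ≫ v)) : Homotopy u v := by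
  obtain ⟨H, h0, h1⟩ := h
  obtain ⟨w, hw, -⟩ := hK.exists_extension₂ (i := i)
    (j := (∂Δ[1] : (Δ[1] : SSet.{0}).Subcomplex).ι) (.inl ⟨inferInstance, hi⟩)
    (endpoints u v) H (by rw [whiskerRight_endpoints, whiskerLeft_boundary_ι, h0, h1])
  exact ⟨w, ept_comp_eq_of_endpoints hw⟩

lemma Homotopic.of_precomp_anodyne {A B K : SSet.{0}} (hK : KanComplex K) {i : A ⟶ B}
    (hi : anodyneExtensions i) {u v : B ⟶ K} (h : Homotopic (i ≫ u) (i ≫ v)) :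
    Homotopic u v := by
  suffices ∀ f g : A ⟶ K, Homotopic f g → ∀ u v : B ⟶ K, i ≫ u = f → i ≫ v = g →
      Homotopic u v from this _ _ h _ _ rfl rfl
  intro f g h
  induction h with
  | rel _ _ h =>
    rintro u v rfl rfl
    exact .of (.of_precomp_anodyne hK hi h)
  | refl f =>
    rintro u v rfl h
    exact .of (.of_precomp_anodyne hK hi (by rw [h]; exact .refl _))
  | symm _ _ _ ih => exact fun u v hu hv ↦ (ih v u hv hu).symm
  | trans f g k _ _ ih₁ ih₂ =>
    intro u v hu hv
    obtain ⟨w, hw⟩ := hK.exists_extension hi g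
    exact (ih₁ u w hu hw).trans (ih₂ w v hw hv)

end Kan

end Paper

namespace Paper

open CartesianMonoidalCategory

section Extension

lemma eq_const_of_mem_horn {m : SimplexCategoryᵒᵖ} (k : Fin 2) (s : (Δ[1] : SSet.{0}).obj m)
    (hs : s ∈ (horn 1 k : (Δ[1] : SSet.{0}).Subcomplex).obj m) : s = stdSimplex.const 1 k m := by
  obtain ⟨m⟩ := m
  induction m using SimplexCategory.rec with | _ m
  ext j : 1
  by_contra h
  refine hs (Set.eq_univ_of_forall fun l ↦ ?_)
  obtain h' | h' : l = k ∨ l = s j :=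
    (by decide : ∀ a b c : Fin 2, a ≠ b → c = b ∨ c = a) (s j) k l h
  · exact .inr h'
  · exact .inl ⟨j, h'.symm⟩

lemma KanComplex.exists_homotopy_extension {K : SSet.{0}} (hK : KanComplex K) {C D : SSet.{0}}
    (i : C ⟶ D) [Mono i] (k l : Fin 2) (H : C ⊗ Δ[1] ⟶ K) (W : D ⟶ K) (h : ept C k ≫ H = i ≫ W) :
    ∃ W' : D ⟶ K, i ≫ W' = ept C l ≫ H := by
  obtain ⟨G, -, hG⟩ := hK.exists_extension₂ (i := i)
    (j := (horn 1 k : (Δ[1] : SSet.{0}).Subcomplex).ι)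
    (.inr ⟨inferInstance, anodyneExtensions.horn_ι k⟩) (fst _ _ ≫ W) H (by
      ext m ⟨x, s, hs⟩
      obtain rfl := eq_const_of_mem_horn k s hs
      exact (congr_app_apply h m x).symm)
  exact ⟨ept D l ≫ G, by rw [← hG, ept_whiskerRight_assoc]⟩

lemma KanComplex.exists_extension_iff {K : SSet.{0}} (hK : KanComplex K) {C D : SSet.{0}}
    (i : C ⟶ D) [Mono i] {w w' : C ⟶ K} (h : Homotopic w w') :
    (∃ W, i ≫ W = w) ↔ ∃ W, i ≫ W = w' := by
  induction h with
  | rel _ _ h =>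
    obtain ⟨H, rfl, rfl⟩ := h
    constructor
    · rintro ⟨W, hW⟩
      exact hK.exists_homotopy_extension i 0 1 H W hW.symm
    · rintro ⟨W, hW⟩
      exact hK.exists_homotopy_extension i 1 0 H W hW.symm
  | refl _ => rfl
  | symm _ _ _ ih => exact ih.symm
  | trans _ _ _ _ _ ih₁ ih₂ => exact ih₁.trans ih₂

/-- If an anodyne map from `A` to a Kan complex `X` is homotopic to a constant map,
then maps to `X` extend along monomorphisms. -/
lemma KanComplex.exists_extension_of_null {A X : SSet.{0}} (hX : KanComplex X) {η : A ⟶ X}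
    (hη : anodyneExtensions η) {z : Δ[0] ⟶ X} (hz : Homotopic η (toPt A ≫ z))
    {C D : SSet.{0}} (i : C ⟶ D) [Mono i] (u : C ⟶ X) : ∃ v, i ≫ v = u := by
  have h : Homotopic (𝟙 X) (toPt X ≫ z) := by
    refine .of_precomp_anodyne hX hη ?_
    rwa [Category.comp_id, ← Category.assoc, comp_toPt]
  have h' := h.precomp u
  rw [Category.comp_id, ← Category.assoc, comp_toPt] at h'
  refine (hX.exists_extension_iff i h').2 ⟨toPt D ≫ z, ?_⟩
  rw [← Category.assoc, comp_toPt]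

end Extension

section Curry

open MonoidalClosed

lemma ept_tensor (A Z : SSet.{0}) (k : Fin 2) :
    A ◁ ept Z k ≫ (α_ A Z Δ[1]).inv = ept (A ⊗ Z) k := rfl

lemma Homotopy.curry {A Z K : SSet.{0}} {f g : A ⊗ Z ⟶ K} (h : Homotopy f g) :
    Homotopy (curry f) (curry g) := by
  obtain ⟨H, rfl, rfl⟩ := h
  exact ⟨MonoidalClosed.curry ((α_ A Z Δ[1]).inv ≫ H),
    by rw [← curry_natural_left, ← Category.assoc, ept_tensor],
    by rw [← curry_natural_left, ← Category.assoc, ept_tensor]⟩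

lemma ept_tensor' (A Z : SSet.{0}) (k : Fin 2) :
    ept (A ⊗ Z) k ≫ (α_ A Z Δ[1]).hom = A ◁ ept Z k := rfl

lemma Homotopy.uncurry {A Z K : SSet.{0}} {f g : Z ⟶ (ihom A).obj K} (h : Homotopy f g) :
    Homotopy (uncurry f) (uncurry g) := by
  obtain ⟨H, rfl, rfl⟩ := h
  exact ⟨(α_ A Z Δ[1]).hom ≫ MonoidalClosed.uncurry H,
    by rw [uncurry_natural_left, ← Category.assoc, ept_tensor'],
    by rw [uncurry_natural_left, ← Category.assoc, ept_tensor']⟩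

lemma Homotopic.curry {A Z K : SSet.{0}} {f g : A ⊗ Z ⟶ K} (h : Homotopic f g) :
    Homotopic (curry f) (curry g) :=
  h.map _ fun _ _ h ↦ h.curry

lemma Homotopic.uncurry {A Z K : SSet.{0}} {f g : Z ⟶ (ihom A).obj K} (h : Homotopic f g) :
    Homotopic (uncurry f) (uncurry g) :=
  h.map _ fun _ _ h ↦ h.uncurry

lemma WeaklyContractible.exists_homotopic_const {A K : SSet.{0}} (hA : WeaklyContractible A)
    (hK : KanComplex K) (u : A ⟶ K) : ∃ z : Δ[0] ⟶ K, Homotopic u (toPt A ≫ z) := by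
  obtain ⟨g, -, hg⟩ := hA K hK
  refine ⟨(ρ_ _).inv ≫ MonoidalClosed.uncurry (MonoidalClosed.curry ((ρ_ A).hom ≫ u) ≫ g), ?_⟩
  have := ((hg.precomp (MonoidalClosed.curry ((ρ_ A).hom ≫ u))).uncurry.precomp (ρ_ A).inv).symm
  rw [← Category.assoc (MonoidalClosed.curry _), uncurry_pre_app, Category.comp_id,
    uncurry_curry, Iso.inv_hom_id_assoc, ← rightUnitor_inv_naturality_assoc] at this
  exact this

lemma KanComplex.ihom {K : SSet.{0}} (hK : KanComplex K) (Z : SSet.{0}) :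
    KanComplex ((ihom Z).obj K) := by
  refine .of_rlp fun A B j hj ↦ ⟨fun {u v} sq ↦ ?_⟩
  have hj' : anodyneExtensions j := fun _ _ _ hp ↦ hp _ hj
  obtain ⟨w, hw⟩ := hK.exists_extension (hj'.whiskerLeft Z) (MonoidalClosed.uncurry u)
  refine ⟨⟨MonoidalClosed.curry w, ?_, hom_ext_pt _ _⟩⟩
  rw [← curry_natural_left, hw, curry_uncurry]

/-- A map is a weak homotopy equivalence as soon as precomposition with it is bijective
on homotopy classes of maps to Kan complexes. -/
lemma WeakHomotopyEquivalence.of_homotopic {X Y : SSet.{0}} (i : X ⟶ Y)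
    (surj : ∀ K : SSet.{0}, KanComplex K → ∀ φ : X ⟶ K, ∃ ψ : Y ⟶ K, Homotopic (i ≫ ψ) φ)
    (inj : ∀ K : SSet.{0}, KanComplex K → ∀ ψ₀ ψ₁ : Y ⟶ K,
      Homotopic (i ≫ ψ₀) (i ≫ ψ₁) → Homotopic ψ₀ ψ₁) :
    WeakHomotopyEquivalence i := by
  intro K hK
  have surj' (Z : SSet.{0}) (φ : X ⊗ Z ⟶ K) : ∃ ψ : Y ⊗ Z ⟶ K, Homotopic (i ▷ Z ≫ ψ) φ := by
    obtain ⟨ψ, hψ⟩ := surj _ (hK.ihom Z) (MonoidalClosed.curry ((β_ _ _).hom ≫ φ))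
    refine ⟨(β_ _ _).hom ≫ MonoidalClosed.uncurry ψ, ?_⟩
    have := hψ.uncurry.precomp (β_ X Z).hom
    rw [uncurry_curry, uncurry_natural_left, SymmetricCategory.symmetry_assoc] at this
    rwa [BraidedCategory.braiding_naturality_left_assoc]
  have inj' (Z : SSet.{0}) (ψ₀ ψ₁ : Y ⊗ Z ⟶ K) (h : Homotopic (i ▷ Z ≫ ψ₀) (i ▷ Z ≫ ψ₁)) :
      Homotopic ψ₀ ψ₁ := by
    have := inj _ (hK.ihom Z) (MonoidalClosed.curry ((β_ _ _).hom ≫ ψ₀))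
      (MonoidalClosed.curry ((β_ _ _).hom ≫ ψ₁)) (by
        have := (h.precomp (β_ Z X).hom).curry
        rw [← curry_natural_left, ← curry_natural_left,
          BraidedCategory.braiding_naturality_right_assoc,
          BraidedCategory.braiding_naturality_right_assoc]
        exact this)
    have := this.uncurry.precomp (β_ Y Z).hom
    rwa [uncurry_curry, uncurry_curry, SymmetricCategory.symmetry_assoc,
      SymmetricCategory.symmetry_assoc] at this
  obtain ⟨ψ, hψ⟩ := surj' _ ((ihom.ev X).app K)
  refine ⟨MonoidalClosed.curry ψ, ?_, ?_⟩
  · have h := inj' _ (Y ◁ (pre i).app K ≫ ψ) ((ihom.ev Y).app K) (by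
      have := hψ.precomp (X ◁ (pre i).app K)
      rw [id_tensor_pre_app_comp_ev] at this
      rwa [whisker_exchange_assoc] at this)
    have := h.curry
    rw [curry_natural_left, ← uncurry_id_eq_ev, curry_uncurry] at this
    exact this
  · have := hψ.curry
    rw [← uncurry_id_eq_ev, curry_uncurry] at this
    rwa [curry_pre_app]

end Curry

section FibrantReplacement

open SSet.modelCategoryQuillen

/-- Factorizations into an anodyne map followed by a Kan fibration. -/
noncomputable def factorization : MorphismProperty.FunctorialFactorizationData
    SSet.modelCategoryQuillen.J.{0}.rlp.llp SSet.modelCategoryQuillen.J.{0}.rlp :=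
  MorphismProperty.functorialFactorizationData _ _

/-- The functor sending `X` to the arrow `X ⟶ Δ[0]`. -/
noncomputable def toPtFunctor : SSet.{0} ⥤ Arrow SSet.{0} where
  obj X := Arrow.mk (toPt X)
  map f := Arrow.homMk f (𝟙 _) (hom_ext_pt _ _)

/-- A functorial fibrant replacement of simplicial sets. -/
noncomputable def fibrantReplacement : SSet.{0} ⥤ SSet.{0} := toPtFunctor ⋙ factorization.Z

/-- The natural anodyne map to the fibrant replacement. -/
noncomputable def toFibrant : 𝟭 SSet.{0} ⟶ fibrantReplacement :=
  Functor.whiskerLeft toPtFunctor factorization.i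

lemma anodyne_toFibrant (X : SSet.{0}) : anodyneExtensions (toFibrant.app X) :=
  factorization.hi _

lemma kanComplex_fibrantReplacement (X : SSet.{0}) : KanComplex (fibrantReplacement.obj X) := by
  refine .of_rlp ?_
  rw [hom_ext_pt (toPt (fibrantReplacement.obj X)) (factorization.p.app (toPtFunctor.obj X))]
  exact factorization.hp _

end FibrantReplacement

end Paper

namespace Paper

open CartesianMonoidalCategory Opposite

section RelativeNerve

variable {J : Type} [SmallCategory J]

/-- The image of the last vertex under a monotone map. -/
def lastVertex {m n : ℕ} (s : Fin (m + 1) →o Fin (n + 1)) : Fin (n + 1) :=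
  s (Fin.last m)

lemma lastVertex_comp_le {l m n : ℕ} (β : Fin (l + 1) →o Fin (m + 1))
    (s : Fin (m + 1) →o Fin (n + 1)) : lastVertex (s.comp β) ≤ lastVertex s :=
  s.monotone (Fin.le_last _)

lemma le_lastVertex {m n : ℕ} (s : Fin (m + 1) →o Fin (n + 1)) (i : Fin (m + 1)) :
    s i ≤ lastVertex s :=
  s.monotone (Fin.le_last _)

/-- The action of the simplex category on chains of composable arrows. -/
abbrev restrict {m n : SimplexCategory} (S : ComposableArrows J n.len) (β : m ⟶ n) :
    ComposableArrows J m.len :=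
  S.whiskerLeft (SimplexCategory.toCat.map β).toFunctor

/-- The `n`-simplices of the relative nerve of a diagram `Q` of simplicial sets: a chain `S` of
`n` composable arrows, together with a compatible family of simplices of the values of `Q`. -/
structure RelSimplex (Q : J ⥤ SSet.{0}) (n : SimplexCategory) where
  /-- the underlying chain of composable arrows -/
  S : ComposableArrows J n.len
  /-- the family of simplices -/
  T : ∀ (m : SimplexCategory) (s : Fin (m.len + 1) →o Fin (n.len + 1)),
    (Q.obj (S.obj (lastVertex s))).obj (op m)
  compat : ∀ {l m : SimplexCategory} (β : l ⟶ m) (s : Fin (m.len + 1) →o Fin (n.len + 1)),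
    (Q.map (S.map (homOfLE (lastVertex_comp_le β.toOrderHom s)))).app (op l)
      (T l (s.comp β.toOrderHom)) =
      (Q.obj (S.obj (lastVertex s))).map β.op (T m s)

namespace RelSimplex

variable {Q : J ⥤ SSet.{0}} {l m n : SimplexCategory}

/-- The simplicial structure on the relative nerve. -/
def map (x : RelSimplex Q n) (β : m ⟶ n) : RelSimplex Q m where
  S := restrict x.S β
  T l s := x.T l (β.toOrderHom.comp s)
  compat γ s := x.compat γ (β.toOrderHom.comp s)

lemma compat_id (x : RelSimplex Q n) (β : m ⟶ n) :
    (Q.map (x.S.map (homOfLE (Fin.le_last (lastVertex β.toOrderHom))))).app (op m)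
      ((x.map β).T m .id) =
    (Q.obj (x.S.obj (lastVertex (n := n.len) .id))).map β.op (x.T n .id) := by
  have aux (b : Fin (m.len + 1) →o Fin (n.len + 1)) (hb : b = β.toOrderHom) :
      (Q.map (x.S.map (homOfLE (Fin.le_last (lastVertex b))))).app (op m) (x.T m (b.comp .id)) =
        (Q.obj (x.S.obj (lastVertex (n := n.len) .id))).map β.op (x.T n .id) := by
    change (Q.map (x.S.map (homOfLE (lastVertex_comp_le b .id)))).app (op m)
      (x.T m (OrderHom.id.comp b)) = _
    obtain rfl := hb.symm
    exact x.compat β .id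
  exact aux _ rfl

/-- The component of a simplex indexed by the identity, transported along an equality
of the underlying chain of composable arrows. -/
def top (x : RelSimplex Q n) {S : ComposableArrows J n.len} (h : x.S = S) :
    (Q.obj (S.obj (Fin.last n.len))).obj (op n) :=
  (Q.map (eqToHom (by rw [h]; rfl) :
    x.S.obj (lastVertex (n := n.len) .id) ⟶ S.obj (Fin.last n.len))).app _ (x.T n .id)

lemma top_rfl (x : RelSimplex Q n) : x.top rfl = x.T n .id :=
  congr_app_apply (Q.map_id _) _ _

lemma top_congr {x y : RelSimplex Q n} (h : x = y) {S : ComposableArrows J n.len} (hx : x.S = S) :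
    x.top hx = y.top (h ▸ hx) := by
  subst h; rfl

lemma map_top (x : RelSimplex Q n) {S : ComposableArrows J n.len} (h : x.S = S) (β : m ⟶ n) :
    (Q.map (S.map (homOfLE (Fin.le_last (lastVertex β.toOrderHom))))).app (op m)
      ((x.map β).top (S := restrict S β) (by rw [← h]; rfl)) =
    (Q.obj (S.obj (Fin.last n.len))).map β.op (x.top h) := by
  subst h
  rw [top_rfl]
  erw [top_rfl]
  exact x.compat_id β

lemma ext_top {x y : RelSimplex Q n} {S : ComposableArrows J n.len} (hx : x.S = S) (hy : y.S = S)
    (h : ∀ (m : SimplexCategory) (s : m ⟶ n),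
      (x.map s).top (S := restrict S s) (by rw [← hx]; rfl) =
        (y.map s).top (S := restrict S s) (by rw [← hy]; rfl)) : x = y := by
  obtain ⟨S₁, T₁, h₁⟩ := x
  obtain ⟨S₂, T₂, h₂⟩ := y
  dsimp at hx hy
  subst hx hy
  congr
  funext m s
  have := h m (SimplexCategory.Hom.mk s)
  erw [top_rfl, top_rfl] at this
  exact this

end RelSimplex

/-- The relative nerve of a diagram of simplicial sets. -/
def relNerve (Q : J ⥤ SSet.{0}) : SSet.{0} where
  obj n := RelSimplex Q n.unop
  map β := ↾fun x ↦ x.map β.unop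
  map_id _ := rfl
  map_comp _ _ := rfl

namespace relNerve

/-- The projection from the relative nerve to the nerve of the indexing category. -/
def proj (Q : J ⥤ SSet.{0}) : relNerve Q ⟶ nerve J where
  app _ := ↾fun x ↦ RelSimplex.S x
  naturality _ _ _ := rfl

/-- The functoriality of the relative nerve with respect to the diagram. -/
def map {Q Q' : J ⥤ SSet.{0}} (τ : Q ⟶ Q') : relNerve Q ⟶ relNerve Q' where
  app n := ↾fun x ↦
    { S := RelSimplex.S x
      T m s := (τ.app _).app _ (RelSimplex.T x m s)
      compat {l m} β s := by
        have h₁ := congr_app_apply (τ.naturality (x.S.map (homOfLE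
          (lastVertex_comp_le β.toOrderHom s)))) (op l) (RelSimplex.T x l (s.comp β.toOrderHom))
        have h₂ := NatTrans.naturality_apply (τ.app (x.S.obj (lastVertex s))) β.op
          (RelSimplex.T x m s)
        refine h₁.symm.trans (Eq.trans ?_ h₂)
        exact congr_arg ((τ.app _).app _) (RelSimplex.compat x β s) }
  naturality _ _ _ := rfl

/-- The map from the relative nerve induced by a cocone. -/
def desc {Q : J ⥤ SSet.{0}} {X : SSet.{0}} (κ : Q ⟶ (Functor.const J).obj X) : relNerve Q ⟶ X where
  app n := ↾fun x ↦ (κ.app _).app _ (RelSimplex.T x n.unop .id)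
  naturality m n β := by
    ext (x : RelSimplex Q m.unop)
    have h₁ : (κ.app (x.S.obj (lastVertex β.unop.toOrderHom))).app n
        ((x.map β.unop).T n.unop .id) =
          (κ.app (x.S.obj (lastVertex .id))).app n ((Q.map (x.S.map (homOfLE
            (Fin.le_last (lastVertex β.unop.toOrderHom))))).app n
              ((x.map β.unop).T n.unop .id)) :=
      (congr_app_apply (κ.naturality (x.S.map (homOfLE
        (Fin.le_last (lastVertex β.unop.toOrderHom))))) n ((x.map β.unop).T n.unop .id)).symm
    have h₂ : (κ.app (x.S.obj (lastVertex .id))).app n ((Q.obj (x.S.obj (lastVertex .id))).map β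
          (x.T m.unop .id)) =
        X.map β ((κ.app (x.S.obj (lastVertex .id))).app m (x.T m.unop .id)) :=
      NatTrans.naturality_apply _ β _
    exact h₁.trans ((congr_arg _ (x.compat_id β.unop)).trans h₂)

lemma map_desc {Q Q' : J ⥤ SSet.{0}} (τ : Q ⟶ Q') {X : SSet.{0}}
    (κ : Q' ⟶ (Functor.const J).obj X) : map τ ≫ desc κ = desc (τ ≫ κ) := rfl

lemma desc_comp {Q : J ⥤ SSet.{0}} {X X' : SSet.{0}} (κ : Q ⟶ (Functor.const J).obj X)
    (f : X ⟶ X') : desc κ ≫ f = desc (κ ≫ (Functor.const J).map f) := rfl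

section Lifting

variable {Q : J ⥤ SSet.{0}} {n : ℕ}

lemma S_app {X : SSet.{0}} (g : X ⟶ relNerve Q) (Sb : X ⟶ nerve J) (h : g ≫ proj Q = Sb)
    (m : SimplexCategory) (x : X.obj (op m)) :
    RelSimplex.S (g.app (op m) x) = Sb.app (op m) x :=
  congr_app_apply h _ x

/-- The map `Δ[n] ⟶ nerve J` corresponding to a chain of composable arrows. -/
def chainMap (S : ComposableArrows J n) : Δ[n] ⟶ nerve J :=
  SSet.yonedaEquiv.symm (show (nerve J).obj (op ⦋n⦌) from S)

variable (S : ComposableArrows J n)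
  (y : (boundary n : (Δ[n] : SSet.{0}).Subcomplex).toSSet ⟶ relNerve Q)
  (h : y ≫ proj Q = (boundary n).ι ≫ chainMap S)

/-- The component at a boundary simplex of a lifting problem. -/
def boundaryValue (m : SimplexCategory) (s : Fin (m.len + 1) →o Fin (n + 1))
    (hs : stdSimplex.objMk s ∈ (boundary n).obj (op m)) :
    (Q.obj (S.obj (lastVertex s))).obj (op m) :=
  RelSimplex.top (y.app (op m) ⟨stdSimplex.objMk s, hs⟩)
    (S := restrict (n := ⦋n⦌) S (SimplexCategory.Hom.mk s)) (S_app y _ h m ⟨stdSimplex.objMk s, hs⟩)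

lemma boundaryValue_compat {l m : SimplexCategory} (β : l ⟶ m)
    (s : Fin (m.len + 1) →o Fin (n + 1)) (hs : stdSimplex.objMk s ∈ (boundary n).obj (op m)) :
    (Q.map (S.map (homOfLE (lastVertex_comp_le β.toOrderHom s)))).app (op l)
        (boundaryValue S y h l (s.comp β.toOrderHom) ((boundary n).map β.op hs)) =
      (Q.obj (S.obj (lastVertex s))).map β.op (boundaryValue S y h m s hs) := by
  have h₁ : y.app (op l) ((boundary n).toSSet.map β.op ⟨stdSimplex.objMk s, hs⟩) =
      RelSimplex.map (y.app (op m) ⟨stdSimplex.objMk s, hs⟩) β := NatTrans.naturality_apply y β.op _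
  have h₂ := RelSimplex.map_top (y.app (op m) ⟨stdSimplex.objMk s, hs⟩)
    (S := restrict (n := ⦋n⦌) S (SimplexCategory.Hom.mk s)) (S_app y _ h m _) β
  have h₃ := RelSimplex.top_congr h₁
    (S := restrict (n := m) (restrict (n := ⦋n⦌) S (SimplexCategory.Hom.mk s)) β)
    (S_app y _ h _ _)
  exact (congr_arg _ h₃).trans h₂

lemma map_map_app {i j k : J} (a : i ⟶ j) (b : j ⟶ k) (c : i ⟶ k) (hc : a ≫ b = c)
    {m : SimplexCategoryᵒᵖ} (x : (Q.obj i).obj m) :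
    (Q.map b).app m ((Q.map a).app m x) = (Q.map c).app m x := by
  subst hc
  simp

/-- The map induced by a lifting problem on the value of the diagram at the last vertex. -/
def boundaryMap : (boundary n : (Δ[n] : SSet.{0}).Subcomplex).toSSet ⟶
    Q.obj (S.obj (Fin.last n)) where
  app m := ↾fun s ↦
    (Q.map (S.map (homOfLE (Fin.le_last _)))).app m
      (boundaryValue S y h m.unop (stdSimplex.asOrderHom s.1) s.2)
  naturality m m' β := by
    ext s
    have h₁ := boundaryValue_compat S y h β.unop (stdSimplex.asOrderHom s.1) s.2
    have h₂ := NatTrans.naturality_apply (Q.map (S.map (homOfLE (Fin.le_last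
      (lastVertex (stdSimplex.asOrderHom s.1)))))) β
        (boundaryValue S y h m.unop (stdSimplex.asOrderHom s.1) s.2)
    refine Eq.trans ?_ h₂
    refine Eq.trans ?_ (congr_arg _ h₁)
    exact (map_map_app _ _ _ (S.map_comp _ _).symm _).symm

lemma lastVertex_eq_last {m : SimplexCategory} (s : Fin (m.len + 1) →o Fin (n + 1))
    (hs : stdSimplex.objMk s ∉ (boundary n).obj (op m)) : lastVertex s = Fin.last n := by
  obtain ⟨i, hi⟩ := not_not.mp hs (Fin.last n)
  exact le_antisymm (Fin.le_last _) (hi.symm.le.trans (le_lastVertex s i))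

open Classical in
/-- The simplex solving a lifting problem. -/
noncomputable def fill (B : Δ[n] ⟶ Q.obj (S.obj (Fin.last n)))
    (hB : (boundary n).ι ≫ B = boundaryMap S y h) : RelSimplex Q ⦋n⦌ where
  S := S
  T m s := if hs : stdSimplex.objMk s ∈ (boundary n).obj (op m) then boundaryValue S y h m s hs
    else (Q.map (S.map (homOfLE (lastVertex_eq_last s hs).ge))).app _
      (B.app (op m) (stdSimplex.objMk s))
  compat {l m} β s := by
    by_cases hs : stdSimplex.objMk s ∈ (boundary n).obj (op m)
    · have hs' : stdSimplex.objMk (s.comp β.toOrderHom) ∈ (boundary n).obj (op l) :=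
        (boundary n).map β.op hs
      rw [dif_pos hs, dif_pos hs']
      exact boundaryValue_compat S y h β s hs
    · have hβ : (Q.obj (S.obj (Fin.last n))).map β.op (B.app (op m) (stdSimplex.objMk s)) =
          B.app (op l) (stdSimplex.objMk (s.comp β.toOrderHom)) :=
        (NatTrans.naturality_apply B β.op (stdSimplex.objMk s)).symm
      rw [dif_neg hs]
      have h₂ := NatTrans.naturality_apply (Q.map (S.map (homOfLE (lastVertex_eq_last s hs).ge)))
        β.op (B.app (op m) (stdSimplex.objMk s))
      rw [← h₂, hβ]
      by_cases hs' : stdSimplex.objMk (s.comp β.toOrderHom) ∈ (boundary n).obj (op l)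
      · rw [dif_pos hs']
        have h₃ := congr_app_apply hB (op l) ⟨_, hs'⟩
        refine Eq.trans ?_ (congr_arg _ h₃.symm)
        exact (map_map_app _ _ _ (S.map_comp _ _).symm _).symm
      · rw [dif_neg hs']
        exact map_map_app _ _ _ (S.map_comp _ _).symm _

lemma fill_T (B : Δ[n] ⟶ Q.obj (S.obj (Fin.last n)))
    (hB : (boundary n).ι ≫ B = boundaryMap S y h) (m : SimplexCategory)
    (s : Fin (m.len + 1) →o Fin (n + 1)) (hs : stdSimplex.objMk s ∈ (boundary n).obj (op m)) :
    (fill S y h B hB).T m s = boundaryValue S y h m s hs :=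
  dif_pos hs

end Lifting

/-- The projection of the relative nerve of a pointwise contractible diagram is a
trivial fibration. -/
lemma rlp_proj {Q : J ⥤ SSet.{0}} (hQ : ∀ (j : J) ⦃A B : SSet.{0}⦄ (i : A ⟶ B) [Mono i]
    (u : A ⟶ Q.obj j), ∃ v, i ≫ v = u) :
    (MorphismProperty.monomorphisms SSet.{0}).rlp (proj Q) := by
  rw [rlp_monomorphisms]
  rintro _ _ _ ⟨n⟩
  refine ⟨fun {y b} sq ↦ ?_⟩
  obtain ⟨S, rfl⟩ : ∃ S : ComposableArrows J n, chainMap S = b :=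
    SSet.yonedaEquiv.symm.surjective b
  obtain ⟨B, hB⟩ := hQ _ (boundary n).ι (boundaryMap S y sq.w)
  refine ⟨⟨⟨SSet.yonedaEquiv.symm
    (show (relNerve Q).obj (op ⦋n⦌) from fill S y sq.w B hB), ?_, ?_⟩⟩⟩
  · ext m s
    let x := fill S y sq.w B hB
    have hs : stdSimplex.objMk (stdSimplex.asOrderHom s.1) ∈ (boundary n).obj m := s.2
    refine RelSimplex.ext_top (S := restrict (n := ⦋n⦌) S (stdSimplex.objEquiv s.1))
      (x := x.map (stdSimplex.objEquiv s.1)) (y := y.app m s) rfl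
      (S_app y _ sq.w m.unop s) fun l β ↦ ?_
    have h₁ : y.app (op l) ((boundary n).toSSet.map β.op s) =
      RelSimplex.map (y.app m s) β := NatTrans.naturality_apply y β.op _
    refine (RelSimplex.top_rfl _).trans ?_
    refine Eq.trans ?_ (RelSimplex.top_congr h₁ (S_app y _ sq.w _ _))
    refine (fill_T S y sq.w B hB l ((stdSimplex.asOrderHom s.1).comp β.toOrderHom)
      ((boundary n).map β.op hs)).trans ?_
    rfl
  · rw [SSet.yonedaEquiv_symm_comp]
    rfl

end relNerve

end RelativeNerve

end Paper

namespace Paper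

open CartesianMonoidalCategory Opposite

section CommaNerves

variable {I J : Type} [SmallCategory I] [SmallCategory J] (f : I ⥤ J)

/-- A chain in a comma category from a cocone on a chain of composable arrows. -/
def commaChain {m : ℕ} {y : J} (x : ComposableArrows I m)
    (c : x ⋙ f ⟶ (Functor.const _).obj y) : ComposableArrows (CostructuredArrow f y) m where
  obj i := CostructuredArrow.mk (c.app i)
  map a := CostructuredArrow.homMk (x.map a) ((c.naturality a).trans (Category.comp_id _))

/-- The diagram of nerves of comma categories. -/
def commaNerve : J ⥤ SSet.{0} := CostructuredArrow.functor f ⋙ nerveFunctor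

/-- The projections from the nerves of the comma categories to the nerve of the source. -/
def commaNerveProj : commaNerve f ⟶ (Functor.const J).obj (nerve I) where
  app y := nerveMap (CostructuredArrow.proj f y)

/-- The comparison of the comma categories of `f` with the slice categories. -/
def commaNerveToOver : commaNerve f ⟶ commaNerve (𝟭 J) where
  app y := nerveMap (CostructuredArrow.toOver f y)

/-- The cocone on a restriction of a chain given by its last vertex. -/
def lastVertexCocone {m n : ℕ} (τ : ComposableArrows I n) (s : Fin (m + 1) →o Fin (n + 1)) :
    (s.monotone.functor ⋙ τ) ⋙ f ⟶ (Functor.const _).obj (f.obj (τ.obj (lastVertex s))) where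
  app i := f.map (τ.map (homOfLE (le_lastVertex s i)))
  naturality i j a := by
    refine Eq.trans ?_ (Category.comp_id _).symm
    exact (f.map_comp _ _).symm.trans (congr_arg f.map (τ.map_comp _ _).symm)

/-- The canonical map to the relative nerve of the comma categories. -/
def toRelNerve : nerve I ⟶ relNerve (commaNerve f) where
  app n := ↾fun τ ↦
    { S := (show ComposableArrows I n.unop.len from τ) ⋙ f
      T m s := commaChain f _ (lastVertexCocone f τ s)
      compat {l m} β s := by
        change commaChain f _ (lastVertexCocone f τ (s.comp β.toOrderHom) ≫
          (Functor.const _).map (f.map ((show ComposableArrows I n.unop.len from τ).map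
            (homOfLE (lastVertex_comp_le β.toOrderHom s))))) =
          commaChain f ((s.comp β.toOrderHom).monotone.functor ⋙
              (show ComposableArrows I n.unop.len from τ))
            (Functor.whiskerLeft (β.toOrderHom.monotone.functor)
              (lastVertexCocone f (show ComposableArrows I n.unop.len from τ) s))
        congr 1
        ext i
        exact (f.map_comp _ _).symm.trans (congr_arg f.map (Functor.map_comp _ _ _).symm) }
  naturality _ _ _ := rfl

lemma toRelNerve_desc : toRelNerve f ≫ relNerve.desc (commaNerveProj f) = 𝟙 _ := rfl

/-- The diagram of fibrant replacements of the nerves of comma categories. -/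
noncomputable def fibrantCommaNerve : J ⥤ SSet.{0} := commaNerve f ⋙ fibrantReplacement

/-- The projections from the fibrant replacements of the nerves of the comma categories. -/
noncomputable def fibrantCommaNerveProj :
    fibrantCommaNerve f ⟶ (Functor.const J).obj (fibrantReplacement.obj (nerve I)) :=
  Functor.whiskerRight (commaNerveProj f) fibrantReplacement ≫
    (Functor.constComp J (nerve I) fibrantReplacement).hom

lemma fibrantCommaNerveProj_app (y : J) : (fibrantCommaNerveProj f).app y =
    fibrantReplacement.map ((commaNerveProj f).app y) :=
  Category.comp_id _

/-- The map from the nerves of the comma categories to their fibrant replacements. -/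
noncomputable def toFibrantCommaNerve : commaNerve f ⟶ fibrantCommaNerve f :=
  Functor.whiskerLeft (commaNerve f) toFibrant

/-- The comparison of the fibrant replacements of the nerves of comma categories. -/
noncomputable def fibrantCommaNerveToOver : fibrantCommaNerve f ⟶ fibrantCommaNerve (𝟭 J) :=
  Functor.whiskerRight (commaNerveToOver f) fibrantReplacement

/-- The canonical map to the relative nerve of the fibrant comma nerves. -/
noncomputable def toFibrantRelNerve : nerve I ⟶ relNerve (fibrantCommaNerve f) :=
  toRelNerve f ≫ relNerve.map (toFibrantCommaNerve f)

lemma toFibrantRelNerve_proj : toFibrantRelNerve f ≫ relNerve.proj _ = nerveMap f := rfl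

lemma toFibrantRelNerve_desc :
    toFibrantRelNerve f ≫ relNerve.desc (fibrantCommaNerveProj f) = toFibrant.app (nerve I) := by
  have h : toFibrantCommaNerve f ≫ fibrantCommaNerveProj f =
      commaNerveProj f ≫ (Functor.const J).map (toFibrant.app (nerve I)) := by
    ext y : 2
    rw [NatTrans.comp_app, fibrantCommaNerveProj_app]
    exact (toFibrant.naturality _).symm
  rw [toFibrantRelNerve, Category.assoc, relNerve.map_desc, h, ← relNerve.desc_comp,
    ← Category.assoc, toRelNerve_desc, Category.id_comp]

/-- The comparison map of relative nerves. -/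
noncomputable def relNerveToOver :
    relNerve (fibrantCommaNerve f) ⟶ relNerve (fibrantCommaNerve (𝟭 J)) :=
  relNerve.map (fibrantCommaNerveToOver f)

lemma relNerveToOver_proj : relNerveToOver f ≫ relNerve.proj _ = relNerve.proj _ := rfl

lemma relNerveToOver_desc :
    relNerveToOver f ≫ relNerve.desc (fibrantCommaNerveProj (𝟭 J)) =
      relNerve.desc (fibrantCommaNerveProj f) ≫ fibrantReplacement.map (nerveMap f) := by
  rw [relNerveToOver, relNerve.map_desc, relNerve.desc_comp]
  congr 1
  ext y : 2
  rw [NatTrans.comp_app, NatTrans.comp_app, fibrantCommaNerveProj_app, fibrantCommaNerveProj_app]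
  exact (fibrantReplacement.map_comp _ _).symm.trans
    (fibrantReplacement.map_comp ((commaNerveProj f).app y) (nerveMap f))

lemma rlp_proj_fibrantCommaNerve
    (h : ∀ y, ∃ z, Homotopic (toFibrant.app (nerve (CostructuredArrow f y))) (toPt _ ≫ z)) :
    (MorphismProperty.monomorphisms SSet.{0}).rlp (relNerve.proj (fibrantCommaNerve f)) :=
  relNerve.rlp_proj fun y _ _ i _ u ↦
    (kanComplex_fibrantReplacement _).exists_extension_of_null
      (anodyne_toFibrant (nerve (CostructuredArrow f y))) (h y).choose_spec i u

section

variable {C D : Type} [SmallCategory C] [SmallCategory D]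

/-- The homotopy on nerves induced by a natural transformation. -/
def nerveHomotopy {F G : C ⥤ D} (α : F ⟶ G) : nerve C ⊗ Δ[1] ⟶ nerve D where
  app m := ↾fun x ↦ Functor.prod' (stdSimplex.asOrderHom x.2).monotone.functor
    (show ComposableArrows C m.unop.len from x.1) ⋙ Functor.uncurry.obj (ComposableArrows.mk₁ α)
  naturality _ _ _ := rfl

lemma homotopy_nerveMap {F G : C ⥤ D} (α : F ⟶ G) : Homotopy (nerveMap F) (nerveMap G) := by
  have h (a : Fin 2) {m : ℕ} (x : ComposableArrows C m) :
      Functor.prod' (OrderHom.const (Fin (m + 1)) a).monotone.functor x ⋙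
        Functor.uncurry.obj (ComposableArrows.mk₁ α) = x ⋙ (ComposableArrows.mk₁ α).obj a := by
    refine CategoryTheory.Functor.ext (fun _ ↦ rfl) fun i j b ↦ ?_
    have : ((ComposableArrows.mk₁ α).map (𝟙 a)).app (x.obj i) = 𝟙 _ :=
      congr_arg (fun t ↦ NatTrans.app t (x.obj i)) ((ComposableArrows.mk₁ α).map_id a)
    refine Eq.trans ?_ ((Category.id_comp _).trans (Category.comp_id _)).symm
    exact (congr_arg (· ≫ ((ComposableArrows.mk₁ α).obj a).map (x.map b)) this).trans
      (Category.id_comp _)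
  refine ⟨nerveHomotopy α, ?_, ?_⟩
  · ext m x
    exact h 0 x
  · ext m x
    exact h 1 x

lemma exists_homotopic_const_of_isTerminal {t : C} (ht : IsTerminal t) :
    ∃ z, Homotopic (𝟙 (nerve C)) (toPt _ ≫ z) :=
  ⟨SSet.yonedaEquiv.symm (show (nerve C).obj (op ⦋0⦌) from (Functor.const _).obj t),
    .of (homotopy_nerveMap (F := 𝟭 C) (G := (Functor.const C).obj t)
      { app c := ht.from c, naturality _ _ _ := ht.hom_ext _ _ })⟩

end

lemma rlp_proj_over : (MorphismProperty.monomorphisms SSet.{0}).rlp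
    (relNerve.proj (fibrantCommaNerve (𝟭 J))) := by
  refine rlp_proj_fibrantCommaNerve _ fun y ↦ ?_
  obtain ⟨z, hz⟩ := exists_homotopic_const_of_isTerminal
    (show IsTerminal (Over.mk (𝟙 y)) from Over.mkIdTerminal)
  exact ⟨z ≫ toFibrant.app (nerve (Over y)), hz.postcomp (toFibrant.app (nerve (Over y)))⟩

lemma exists_section {E B : SSet.{0}} {p : E ⟶ B}
    (hp : (MorphismProperty.monomorphisms SSet.{0}).rlp p) : ∃ s, s ≫ p = 𝟙 B := by
  have : Mono (initial.to B) := inferInstance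
  have := hp _ this
  have sq : CommSq (initial.to E) (initial.to B) p (𝟙 B) := ⟨by simp⟩
  exact ⟨sq.lift, sq.fac_right⟩

/-- If the comma categories of `f` have weakly contractible nerves, there is an inverse of the
map induced by `f` on nerves up to fibrant replacement. -/
lemma exists_inverse (h : ∀ y : J, WeaklyContractible (nerve (CostructuredArrow f y))) :
    ∃ θ : nerve J ⟶ fibrantReplacement.obj (nerve I),
      Homotopic (nerveMap f ≫ θ) (toFibrant.app (nerve I)) ∧
      Homotopic (θ ≫ fibrantReplacement.map (nerveMap f)) (toFibrant.app (nerve J)) := by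
  have hf := rlp_proj_fibrantCommaNerve f fun y ↦
    (h y).exists_homotopic_const (kanComplex_fibrantReplacement _) (toFibrant.app _)
  obtain ⟨s, hs⟩ := exists_section hf
  refine ⟨s ≫ relNerve.desc (fibrantCommaNerveProj f), ?_, ?_⟩
  · rw [← toFibrantRelNerve_desc f, ← Category.assoc]
    refine .of (Homotopy.postcomp (.of_rlp hf ?_) _)
    rw [Category.assoc, hs, toFibrantRelNerve_proj, Category.comp_id]
  · rw [← toFibrantRelNerve_desc (𝟭 J), Category.assoc, ← relNerveToOver_desc, ← Category.assoc]
    refine .of (Homotopy.postcomp (.of_rlp rlp_proj_over ?_) _)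
    rw [Category.assoc, relNerveToOver_proj, hs, toFibrantRelNerve_proj (𝟭 J)]
    rfl

end CommaNerves

end Paper

/-- Quillen's Theorem A. If all the comma categories `f ↓ y` have
weakly contractible nerves, then `N f : N I ⟶ N J` is a weak homotopy equivalence. -/
theorem quillen_theorem_A {I J : Type} [SmallCategory I] [SmallCategory J] (f : I ⥤ J)
    (h : ∀ y : J, Paper.WeaklyContractible (nerve (CostructuredArrow f y))) :
    Paper.WeakHomotopyEquivalence (nerveFunctor.map (X := Cat.of I) (Y := Cat.of J) f.toCatHom) := by
  obtain ⟨θ, hθ₁, hθ₂⟩ := Paper.exists_inverse f h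
  change Paper.WeakHomotopyEquivalence (nerveMap f)
  have hη : nerveMap f ≫ Paper.toFibrant.app (nerve J) =
      Paper.toFibrant.app (nerve I) ≫ Paper.fibrantReplacement.map (nerveMap f) :=
    Paper.toFibrant.naturality (nerveMap f)
  refine .of_homotopic _ (fun K hK φ ↦ ?_) fun K hK ψ₀ ψ₁ hψ ↦ ?_
  · obtain ⟨φ, rfl⟩ := hK.exists_extension (Paper.anodyne_toFibrant (nerve I)) φ
    refine ⟨θ ≫ φ, ?_⟩
    rw [← Category.assoc]
    exact hθ₁.postcomp φ
  · obtain ⟨ψ₀, rfl⟩ := hK.exists_extension (Paper.anodyne_toFibrant (nerve J)) ψ₀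
    obtain ⟨ψ₁, rfl⟩ := hK.exists_extension (Paper.anodyne_toFibrant (nerve J)) ψ₁
    rw [← Category.assoc, ← Category.assoc, hη, Category.assoc, Category.assoc] at hψ
    have hψ' := (Paper.Homotopic.of_precomp_anodyne hK (Paper.anodyne_toFibrant _) hψ).precomp θ
    rw [← Category.assoc, ← Category.assoc] at hψ'
    exact (hθ₂.postcomp ψ₀).symm.trans (hψ'.trans (hθ₂.postcomp ψ₁))
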